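/- Left multiplication by an elementary tensor is a rank contraction: for every M-bimodule L, all a, b ∈ M, and every η ∈ L, one has [(a ⊗ bᵒᵖ) • η] ≤ [η]. -/

import Mathlib

/- Common setup: a von Neumann algebra `M` acting on a complex Hilbert space `H`,
a positive faithful normal unital trace `τ`, the algebraic tensor product
`A := M ⊗[ℂ] Mᵐᵒᵖ`, bimodules as left `A`-modules and the rank `[ξ]` of an element. -/

set_option maxHeartbeats 1000000
set_option synthInstance.maxHeartbeats 1000000

noncomputable section

open scoped TensorProduct

namespace RankCompletion

variable {H : Type*} [NormedAddCommGroup H] [InnerProductSpace ℂ H] [CompleteSpace H]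

instance : SMulMemClass (VonNeumannAlgebra H) ℂ (H →L[ℂ] H) where
  smul_mem {s} c a ha := by simpa using s.toStarSubalgebra.smul_mem ha c

/-- `p` is a projection in the von Neumann algebra `M`: `p = p*` and `p² = p`. -/
def IsProj (M : VonNeumannAlgebra H) (p : M) : Prop :=
  star p = p ∧ p * p = p

/-- `τ` is a unital, tracial, positive, faithful and normal ℂ-linear functional on `M`. -/
structure IsFiniteTrace (M : VonNeumannAlgebra H) (τ : M →ₗ[ℂ] ℂ) : Prop where
  unital : τ 1 = 1
  tracial : ∀ x y : M, τ (x * y) = τ (y * x)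
  pos_re : ∀ x : M, 0 ≤ (τ (star x * x)).re
  pos_im : ∀ x : M, (τ (star x * x)).im = 0
  faithful : ∀ x : M, τ (star x * x) = 0 → x = 0
  normal : ∀ (p : ℕ → M) (q : M), (∀ n, IsProj M (p n)) → IsProj M q →
    (∀ i j, i ≠ j → p i * p j = 0) →
    (∀ v : H, Filter.Tendsto
        (fun n => (((∑ k ∈ Finset.range n, p k : M) : H →L[ℂ] H)) v)
        Filter.atTop (nhds ((q : H →L[ℂ] H) v))) →
    (τ q).re = ∑' n, (τ (p n)).re

/-- The algebraic tensor product `A = M ⊗_ℂ Mᵐᵒᵖ`; an `M`-bimodule is a left `A`-module. -/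
abbrev BimodRing (M : VonNeumannAlgebra H) : Type _ := (↥M) ⊗[ℂ] (↥M)ᵐᵒᵖ

/-- The rank `[ξ]` of an element `ξ` of an `M`-bimodule `L`:
the infimum of `re τ(p) + re τ(q)` over projections `p q` with `((1-p) ⊗ (1-q)ᵒᵖ) • ξ = 0`. -/
def rank (M : VonNeumannAlgebra H) (τ : M →ₗ[ℂ] ℂ) {L : Type*} [AddCommGroup L]
    [Module (BimodRing M) L] (ξ : L) : ℝ :=
  sInf { r : ℝ | ∃ p q : M, IsProj M p ∧ IsProj M q ∧
    (((1 - p) ⊗ₜ[ℂ] (MulOpposite.op (1 - q)) : BimodRing M)) • ξ = 0 ∧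
    r = (τ p).re + (τ q).re }

lemma zero_tmul_smul {A : Type*} [Ring A] [Algebra ℂ A] {L : Type*} [AddCommGroup L]
    [Module (A ⊗[ℂ] Aᵐᵒᵖ) L] {x : A} (hx : x = 0) (y : Aᵐᵒᵖ) (η : L) :
    (x ⊗ₜ[ℂ] y : A ⊗[ℂ] Aᵐᵒᵖ) • η = 0 := by
  have : (x ⊗ₜ[ℂ] y : A ⊗[ℂ] Aᵐᵒᵖ) = 0 := by rw [hx, TensorProduct.zero_tmul]
  rw [this]
  exact zero_smul (A ⊗[ℂ] Aᵐᵒᵖ) η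

lemma tmul_smul_tmul_smul_eq_zero {A : Type*} [Ring A] [Algebra ℂ A] {L : Type*}
    [AddCommGroup L] [Module (A ⊗[ℂ] Aᵐᵒᵖ) L] {a b c d p q : A} {η : L}
    (ha : c * a = c * a * p) (hb : b * d = q * (b * d))
    (hη : (p ⊗ₜ[ℂ] MulOpposite.op q : A ⊗[ℂ] Aᵐᵒᵖ) • η = 0) :
    (c ⊗ₜ[ℂ] MulOpposite.op d : A ⊗[ℂ] Aᵐᵒᵖ) •
      (a ⊗ₜ[ℂ] MulOpposite.op b : A ⊗[ℂ] Aᵐᵒᵖ) • η = 0 := by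
  rw [smul_smul, Algebra.TensorProduct.tmul_mul_tmul, ← MulOpposite.op_mul, ha, hb,
    MulOpposite.op_mul, ← Algebra.TensorProduct.tmul_mul_tmul, ← smul_smul, hη, smul_zero]

lemma norm_abs_apply (x : H →L[ℂ] H) (u : H) : ‖CFC.abs x u‖ = ‖x u‖ := by
  have hsa : star (CFC.abs x) = CFC.abs x :=
    (IsSelfAdjoint.of_nonneg (CFC.abs_nonneg x)).star_eq
  have h : star (CFC.abs x) * CFC.abs x = star x * x := by rw [hsa, CFC.abs_mul_abs]
  rw [← sq_eq_sq₀ (norm_nonneg _) (norm_nonneg _),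
    ContinuousLinearMap.apply_norm_sq_eq_inner_adjoint_left,
    ContinuousLinearMap.apply_norm_sq_eq_inner_adjoint_left]
  exact congrArg (fun z : H →L[ℂ] H => RCLike.re (inner ℂ (z u) u)) h

/-- Polar decomposition `x = v |x|`, where the initial projection `v* v` is the projection onto
the closure of the range of `|x|`. -/
lemma exists_polar_decomposition (x : H →L[ℂ] H) :
    ∃ v : H →L[ℂ] H, v * CFC.abs x = x ∧ v * (star v * v) = v ∧
      star v * v * CFC.abs x = CFC.abs x ∧
      ∀ z : H →L[ℂ] H, z * CFC.abs x = 0 → z * (star v * v) = 0 := by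
  set h := CFC.abs x
  set K : Submodule ℂ H := h.range.topologicalClosure
  have hmem : ∀ u, h u ∈ K := fun u => h.range.le_topologicalClosure ⟨u, rfl⟩
  have : CompleteSpace K := h.range.isClosed_topologicalClosure.completeSpace_coe
  set e : H →ₗ[ℂ] K := h.toLinearMap.codRestrict K hmem
  have hdense : DenseRange e := by
    intro k
    rw [Topology.IsInducing.subtypeVal.closure_eq_preimage_closure_image, ← Set.range_comp]
    exact k.2
  have hnorm : ∀ u, ‖x u‖ = ‖e u‖ := fun u => (norm_abs_apply x u).symm
  set w : K →L[ℂ] H := x.toLinearMap.extendOfNorm e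
  have hw : ∀ u, w (e u) = x u :=
    LinearMap.extendOfNorm_eq hdense ⟨1, fun u => by simpa using (hnorm u).le⟩
  have hwnorm : ∀ k, ‖w k‖ = ‖k‖ := fun k =>
    hdense.induction_on (p := fun k => ‖w k‖ = ‖k‖) k
      (isClosed_eq (by fun_prop) (by fun_prop)) fun u => by rw [hw, hnorm]
  have hwinner : ∀ k l, inner ℂ (w k) (w l) = inner ℂ k l :=
    (LinearIsometry.mk w.toLinearMap hwnorm).inner_map_map
  set v : H →L[ℂ] H := w ∘L K.orthogonalProjectionOnto
  have hP : ∀ u, h u = K.starProjection (h u) := fun u =>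
    (Submodule.starProjection_eq_self_iff.2 (hmem u)).symm
  have hv : star v * v = K.starProjection := by
    refine ContinuousLinearMap.ext fun u => ext_inner_left ℂ fun t => ?_
    rw [ContinuousLinearMap.star_eq_adjoint, mul_apply_eq_comp,
      ContinuousLinearMap.adjoint_inner_right]
    exact (hwinner _ _).trans (Submodule.inner_orthogonalProjectionOnto_eq_of_mem_right _ _)
  refine ⟨v, ?_, ?_, ?_, fun z hz => ?_⟩
  · ext u
    exact (congrArg w (Submodule.orthogonalProjectionOnto_mem_subspace_eq_self (e u))).trans (hw u)
  · rw [hv]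
    ext u
    exact congrArg w (Submodule.orthogonalProjectionOnto_mem_subspace_eq_self _)
  · rw [hv]
    ext u
    exact (hP u).symm
  · rw [hv]
    have hzK : ∀ k : K, z k = 0 := fun k =>
      hdense.induction_on (p := fun k : K => z k = 0) k
        (isClosed_eq (by fun_prop) (by fun_prop)) fun u => DFunLike.congr_fun hz u
    ext u
    exact hzK (K.orthogonalProjectionOnto u)

/-- The partial isometry of the polar decomposition of an element of `M` lies in `M`. -/
lemma exists_partialIsometry (M : VonNeumannAlgebra H) (x : M) :
    ∃ v : M, v * (star v * v) = v ∧ v * star v * x = x ∧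
      ∀ p : M, star p = p → x * p = x → p * (star v * v) = star v * v := by
  obtain ⟨v, hvh, hve, heh, hz⟩ :=
    exists_polar_decomposition (x : H →L[ℂ] H)
  set h := CFC.abs (x : H →L[ℂ] H)
  have hsa : star h = h := (IsSelfAdjoint.of_nonneg (CFC.abs_nonneg _)).star_eq
  have hcomm : ∀ y ∈ M.commutant, Commute (x : H →L[ℂ] H) y := fun y hy =>
    VonNeumannAlgebra.mem_commutant_iff.1 hy x x.2
  have hinv : ∀ y ∈ M.commutant, star v * v * y * (star v * v) = y * (star v * v) := by
    intro y hy
    have hyh : h * y = y * h := (hcomm y hy).cfcAbs_left (hcomm _ (star_mem hy))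
    have := hz ((1 - star v * v) * y) (by
      rw [mul_assoc, ← hyh, ← mul_assoc, sub_mul, one_mul, heh, sub_self, zero_mul])
    rw [sub_mul, one_mul, sub_mul, sub_eq_zero] at this
    exact this.symm
  have hvM : v ∈ M := by
    rw [← M.commutant_commutant, VonNeumannAlgebra.mem_commutant_iff]
    intro y hy
    have hey : star v * v * y = y * (star v * v) := by
      have := congrArg star (hinv (star y) (star_mem hy))
      simp only [star_mul, star_star] at this
      rw [← this, ← mul_assoc, hinv y hy]
    have hyh : h * y = y * h := (hcomm y hy).cfcAbs_left (hcomm _ (star_mem hy))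
    have := hz (y * v - v * y) (by
      rw [sub_mul, mul_assoc, mul_assoc, ← hyh, ← mul_assoc v, hvh, (hcomm y hy).eq, sub_self])
    rwa [sub_mul, mul_assoc, hve, mul_assoc, ← hey, ← mul_assoc, hve, sub_eq_zero] at this
  refine ⟨⟨v, hvM⟩, Subtype.ext hve, Subtype.ext ?_, fun p hp hxp => Subtype.ext ?_⟩
  · change v * star v * (x : H →L[ℂ] H) = x
    rw [← hvh, mul_assoc, ← mul_assoc (star v), heh]
  · change (p : H →L[ℂ] H) * (star v * v) = star v * v
    have hp' : star (p : H →L[ℂ] H) = p := congrArg Subtype.val hp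
    have hxp' : (x : H →L[ℂ] H) * p = x := congrArg Subtype.val hxp
    have hhp : h * p = h := by
      ext u
      rw [← sub_eq_zero, ← norm_eq_zero]
      have : (h * (p : H →L[ℂ] H)) u - h u = h ((p : H →L[ℂ] H) u - u) := by simp
      rw [this, norm_abs_apply, map_sub,
        ← mul_apply_eq_comp, hxp', sub_self, norm_zero]
    have hph : (p : H →L[ℂ] H) * h = h := by
      simpa [hsa, hp'] using congrArg star hhp
    have := hz (1 - p) (by rw [sub_mul, one_mul, hph, sub_self])
    rw [sub_mul, one_mul, sub_eq_zero] at this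
    exact this.symm

namespace IsFiniteTrace

variable {M : VonNeumannAlgebra H} {τ : M →ₗ[ℂ] ℂ}

lemma re_nonneg_of_isProj (hτ : IsFiniteTrace M τ) {p : M} (hp : IsProj M p) :
    0 ≤ (τ p).re := by
  have := hτ.pos_re p
  rwa [hp.1, hp.2] at this

/-- The range projection of `x` has trace at most that of any projection `p` with `x p = x`. -/
lemma exists_isProj_mul_eq (hτ : IsFiniteTrace M τ) {x p : M} (hp : IsProj M p)
    (hx : x * p = x) :
    ∃ f : M, IsProj M f ∧ f * x = x ∧ (τ f).re ≤ (τ p).re := by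
  obtain ⟨v, hv, hvx, hle⟩ := exists_partialIsometry M x
  have hpe := hle p hp.1 hx
  have hep : star v * v * p = star v * v := by
    simpa [mul_assoc, hp.1] using congrArg star hpe
  have hee : star v * v * (star v * v) = star v * v := by rw [mul_assoc, hv]
  refine ⟨v * star v, ⟨by simp, ?_⟩, hvx, ?_⟩
  · rw [← mul_assoc, mul_assoc v, hv]
  · have hproj : IsProj M (p - star v * v) := by
      refine ⟨by simp [hp.1], ?_⟩
      rw [sub_mul, mul_sub, mul_sub, hp.2, hpe, hep, hee]
      abel
    have := hτ.re_nonneg_of_isProj hproj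
    rw [map_sub, Complex.sub_re] at this
    rw [hτ.tracial]
    linarith

end IsFiniteTrace

/-- Left multiplication by an elementary tensor is a rank contraction:
`[(a ⊗ bᵒᵖ) • η] ≤ [η]`. -/
theorem rank_tmul_smul_le (M : VonNeumannAlgebra H) (τ : M →ₗ[ℂ] ℂ)
    (hτ : IsFiniteTrace M τ)
    {L : Type*} [AddCommGroup L] [Module (BimodRing M) L]
    (a b : M) (η : L) :
    rank M τ (((a ⊗ₜ[ℂ] MulOpposite.op b : BimodRing M)) • η) ≤ rank M τ η := by
  refine le_csInf ⟨_, 1, 1, ⟨star_one _, one_mul _⟩, ⟨star_one _, one_mul _⟩,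
    zero_tmul_smul (sub_self 1) _ η, rfl⟩ ?_
  rintro _ ⟨p, q, hp, hq, hη, rfl⟩
  obtain ⟨f, hf, hfa, hfp⟩ := hτ.exists_isProj_mul_eq (x := a * p) hp
    (by rw [mul_assoc, hp.2])
  obtain ⟨g, hg, hgb, hgq⟩ := hτ.exists_isProj_mul_eq (x := star b * q) hq
    (by rw [mul_assoc, hq.2])
  have hbg : q * b * g = q * b := by
    simpa [mul_assoc, hq.1, hg.1] using congrArg star hgb
  have ha : (1 - f) * a = (1 - f) * a * (1 - p) := by
    rw [mul_sub, mul_one, mul_assoc, sub_mul 1 f (a * p), one_mul, hfa, sub_self,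
      sub_zero]
  have hb : b * (1 - g) = (1 - q) * (b * (1 - g)) := by
    rw [sub_mul 1 q, one_mul, ← mul_assoc q, mul_sub (q * b), mul_one, hbg, sub_self, sub_zero]
  refine le_trans (csInf_le ⟨0, ?_⟩ ⟨f, g, hf, hg, ?_, rfl⟩) (add_le_add hfp hgq)
  · rintro _ ⟨p', q', hp', hq', -, rfl⟩
    exact add_nonneg (hτ.re_nonneg_of_isProj hp') (hτ.re_nonneg_of_isProj hq')
  · exact tmul_smul_tmul_smul_eq_zero ha hb hη

end RankCompletion
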